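/- arXiv:2112.02884 — 2 statements merged into one kernel-verified Lean document; each statement's English description precedes it below -/
import Mathlib

section
/- Graphs with identical leading structure have identical equilibria (Proposition 5): let H and H' be two graphs satisfying the assumptions of the invitation-contest setting, with requesters p, p' and agent sets U, U', and fix the same l, u, c, M, F for both. Suppose ψ : U → U' is a bijection such that for all i, j ∈ U, i leads j in H if and only if ψ(i) leads ψ(j) in H'. If r : U → [l, u] is an equilibrium threshold profile for H, then r ∘ ψ⁻¹ : U' → [l, u] is an equilibrium threshold profile for H'; in particular, each agent i of H has the same equilibrium threshold as the corresponding agent ψ(i) of H'. -/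
open Finset

/-- `x` leads `y` (with requester `p`): `x ≠ y` and every walk from `p` to `y` contains `x`
in its support. -/
def Leads {V : Type*} (H : SimpleGraph V) (p x y : V) : Prop :=
  x ≠ y ∧ ∀ w : H.Walk p y, x ∈ w.support

variable {V : Type*} [Fintype V] [DecidableEq V]

/-- The agents: all vertices other than the requester `p`. -/
def agents (p : V) : Finset V := Finset.univ.filter (· ≠ p)

/-- `Dset H p i`: the set of agents led by `i`. -/
noncomputable def Dset (H : SimpleGraph V) (p i : V) : Finset V :=
  @Finset.filter _ (fun j => Leads H p i j) (Classical.decPred _) (agents p)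

/-- `Pset H p i`: the competitors of `i`, namely `U \ (D_i ∪ {i})`. -/
noncomputable def Pset (H : SimpleGraph V) (p i : V) : Finset V :=
  agents p \ insert i (Dset H p i)

/-- Agent `i`'s expected utility for contributing with ability `q`:
`π_i(q) = M * ∏_{j ∈ P_i} F (max (r j) q) - c`. -/
noncomputable def piU (H : SimpleGraph V) (p : V) (c M : ℝ) (F : ℝ → ℝ)
    (r : V → ℝ) (i : V) (q : ℝ) : ℝ :=
  M * (∏ j ∈ Pset H p i, F (max (r j) q)) - c

/-- `r` is an equilibrium threshold profile: every threshold lies in `[l,u]`, every agent has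
strictly positive utility for contributing with any ability strictly above her threshold, and
each threshold is either `l` or gives nonpositive utility. -/
def IsEqm (H : SimpleGraph V) (p : V) (l u c M : ℝ) (F : ℝ → ℝ) (r : V → ℝ) : Prop :=
  (∀ i ∈ agents p, r i ∈ Set.Icc l u) ∧
  (∀ i ∈ agents p, ∀ q ∈ Set.Ioc (r i) u, 0 < piU H p c M F r i q) ∧
  (∀ i ∈ agents p, r i = l ∨ piU H p c M F r i (r i) ≤ 0)

/-- The leader-of-mediocre probability `p_i^lom = ∏_{k ∈ D_i} F (r k)`. -/
noncomputable def lom (H : SimpleGraph V) (p : V) (F : ℝ → ℝ) (r : V → ℝ) (i : V) : ℝ :=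
  ∏ k ∈ Dset H p i, F (r k)

theorem mem_Pset {H : SimpleGraph V} {p i j : V} :
    j ∈ Pset H p i ↔ j ∈ agents p ∧ j ≠ i ∧ ¬ Leads H p i j := by
  simp only [Pset, Dset, mem_sdiff, mem_insert, mem_filter]
  tauto

/-- A bijection of agents that preserves the leading relation maps the competitors of `i`
bijectively onto the competitors of `ψ i`. -/
theorem bijOn_Pset {V' : Type*} [Fintype V'] [DecidableEq V']
    {H : SimpleGraph V} {p : V} {H' : SimpleGraph V'} {p' : V'} {ψ : V → V'}
    (hψ : Set.BijOn ψ (agents p : Set V) (agents p' : Set V'))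
    (hψlead : ∀ i ∈ agents p, ∀ j ∈ agents p,
      (Leads H p i j ↔ Leads H' p' (ψ i) (ψ j)))
    {i : V} (hi : i ∈ agents p) :
    Set.BijOn ψ (Pset H p i : Set V) (Pset H' p' (ψ i) : Set V') := by
  refine ⟨fun j hj => ?_, hψ.injOn.mono fun j hj => (mem_Pset.1 hj).1, fun k hk => ?_⟩
  · obtain ⟨hjp, hji, hlead⟩ := mem_Pset.1 hj
    exact mem_Pset.2 ⟨hψ.mapsTo hjp, fun h => hji (hψ.injOn hjp hi h),
      fun h => hlead ((hψlead i hi j hjp).2 h)⟩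
  · obtain ⟨hkp, hki, hlead⟩ := mem_Pset.1 hk
    obtain ⟨j, hj, rfl⟩ := hψ.surjOn hkp
    exact ⟨j, mem_Pset.2 ⟨hj, fun h => hki (congrArg ψ h),
      fun h => hlead ((hψlead i hi j hj).1 h)⟩, rfl⟩

/-- Corresponding agents have the same expected utility. -/
theorem piU_apply_of_bijOn {V' : Type*} [Fintype V'] [DecidableEq V']
    {H : SimpleGraph V} {p : V} {H' : SimpleGraph V'} {p' : V'} {ψ : V → V'}
    (hψ : Set.BijOn ψ (agents p : Set V) (agents p' : Set V'))
    (hψlead : ∀ i ∈ agents p, ∀ j ∈ agents p,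
      (Leads H p i j ↔ Leads H' p' (ψ i) (ψ j)))
    (c M : ℝ) (F : ℝ → ℝ) {r : V → ℝ} {r' : V' → ℝ}
    (hr' : ∀ i ∈ agents p, r' (ψ i) = r i) {i : V} (hi : i ∈ agents p) (q : ℝ) :
    piU H' p' c M F r' (ψ i) q = piU H p c M F r i q := by
  have hbij := bijOn_Pset hψ hψlead hi
  have hprod : ∏ j ∈ Pset H p i, F (max (r j) q) =
      ∏ k ∈ Pset H' p' (ψ i), F (max (r' k) q) :=
    prod_nbij ψ hbij.mapsTo hbij.injOn hbij.surjOn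
      fun j hj => by rw [hr' j (mem_Pset.1 hj).1]
  rw [piU, piU, hprod]

/-- Graphs with identical leading structure have identical equilibria (Proposition 5): if
`ψ` is a bijection from the agents of `H` to the agents of `H'` preserving the leading
relation, and `r` is an equilibrium threshold profile for `H`, then any profile `r'` for `H'`
with `r' (ψ i) = r i` on agents (i.e. `r ∘ ψ⁻¹`) is an equilibrium threshold profile for
`H'`. -/
theorem identical_leading_structure_identical_equilibria
    {V : Type*} [Fintype V] [DecidableEq V] {V' : Type*} [Fintype V'] [DecidableEq V']
    (H : SimpleGraph V) (p : V) (hreach : ∀ v : V, Nonempty (H.Walk p v))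
    (H' : SimpleGraph V') (p' : V') (hreach' : ∀ v : V', Nonempty (H'.Walk p' v))
    (l u c M : ℝ) (hlu : l < u) (hc : 0 < c) (hcM : c < M)
    (F : ℝ → ℝ) (hFcont : ContinuousOn F (Set.Icc l u))
    (hFmono : StrictMonoOn F (Set.Icc l u)) (hFl : F l = 0) (hFu : F u = 1)
    (ψ : V → V') (hψ : Set.BijOn ψ (agents p : Set V) (agents p' : Set V'))
    (hψlead : ∀ i ∈ agents p, ∀ j ∈ agents p,
      (Leads H p i j ↔ Leads H' p' (ψ i) (ψ j)))
    (r : V → ℝ) (heqm : IsEqm H p l u c M F r)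
    (r' : V' → ℝ) (hr' : ∀ i ∈ agents p, r' (ψ i) = r i) :
    IsEqm H' p' l u c M F r' := by
  obtain ⟨hIcc, hpos, hle⟩ := heqm
  have hpi := fun {i} (hi : i ∈ agents p) q => piU_apply_of_bijOn hψ hψlead c M F hr' hi q
  refine ⟨fun k hk => ?_, fun k hk q hq => ?_, fun k hk => ?_⟩ <;>
    obtain ⟨i, hi, rfl⟩ := hψ.surjOn hk
  · rw [hr' i hi]
    exact hIcc i hi
  · rw [hr' i hi] at hq
    rw [hpi hi]
    exact hpos i hi q hq
  · rw [hpi hi, hr' i hi]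
    exact hle i hi
end

section
/- Agents of the same type have identical thresholds (Theorem 5): let r be an equilibrium threshold profile and let i, j be agents. Suppose there exists a bijection φ : D_i → D_j such that for all a, b ∈ D_i, a leads b if and only if φ(a) leads φ(b) (i.e., the rooted order-tree subtrees of descendants of i and of j are isomorphic, so i and j are of the same type). Then r_i = r_j. -/
open Finset

variable {V : Type*} [Fintype V] [DecidableEq V]

theorem Leads.asymm {W : Type*} [DecidableEq W] {H : SimpleGraph W} {p x y : W}
    (hreach : Nonempty (H.Walk p y))
    (hxy : Leads H p x y) : ¬ Leads H p y x := by
  intro hyx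
  obtain ⟨w⟩ := hreach
  have hx : x ∈ w.bypass.support := hxy.2 _
  exact SimpleGraph.Walk.endpoint_notMem_support_takeUntil w.bypass_isPath hx hxy.1.symm
    (hyx.2 _)

theorem Leads.trans {W : Type*} [DecidableEq W] {H : SimpleGraph W} {p x y z : W}
    (hreach : Nonempty (H.Walk p y))
    (hxy : Leads H p x y) (hyz : Leads H p y z) : Leads H p x z := by
  refine ⟨?_, fun w => w.support_takeUntil_subset_support (hyz.2 w) (hxy.2 _)⟩
  rintro rfl
  exact hxy.asymm hreach hyz

theorem mem_Dset {H : SimpleGraph V} {p i k : V} :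
    k ∈ Dset H p i ↔ k ∈ agents p ∧ Leads H p i k := by
  simp [Dset]

theorem notMem_Dset_self (H : SimpleGraph V) (p i : V) : i ∉ Dset H p i :=
  fun h => (mem_Dset.1 h).2.1 rfl

theorem Dset_ssubset_of_mem {H : SimpleGraph V} {p i k : V} (hreach : Nonempty (H.Walk p k))
    (hk : k ∈ Dset H p i) : Dset H p k ⊂ Dset H p i := by
  refine (Finset.ssubset_iff_of_subset fun b hb => ?_).2 ⟨k, hk, notMem_Dset_self H p k⟩
  exact mem_Dset.2 ⟨(mem_Dset.1 hb).1, (mem_Dset.1 hk).2.trans hreach (mem_Dset.1 hb).2⟩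

theorem prod_agents_eq (H : SimpleGraph V) {p i : V} (hi : i ∈ agents p) (f : V → ℝ) :
    ∏ k ∈ agents p, f k = (∏ k ∈ Pset H p i, f k) * (f i * ∏ k ∈ Dset H p i, f k) := by
  rw [← Finset.prod_insert (notMem_Dset_self H p i), Pset, Finset.prod_sdiff]
  exact Finset.insert_subset hi fun k hk => (mem_Dset.1 hk).1

/-- The restriction of a leads-preserving bijection to the agents led by `k`. -/
theorem bijOn_Dset_of_mem {H : SimpleGraph V} {p i j k : V} {φ : V → V}
    (hreach : ∀ v : V, Nonempty (H.Walk p v))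
    (hφ : Set.BijOn φ (Dset H p i : Set V) (Dset H p j : Set V))
    (hφlead : ∀ a ∈ Dset H p i, ∀ b ∈ Dset H p i,
      (Leads H p a b ↔ Leads H p (φ a) (φ b)))
    (hk : k ∈ Dset H p i) :
    Set.BijOn φ (Dset H p k : Set V) (Dset H p (φ k) : Set V) := by
  have hsub := (Dset_ssubset_of_mem (hreach k) hk).1
  have hsub' := (Dset_ssubset_of_mem (hreach (φ k)) (hφ.mapsTo hk)).1
  refine ⟨fun b hb => ?_, hφ.injOn.mono hsub, fun y hy => ?_⟩
  · exact mem_Dset.2 ⟨(mem_Dset.1 (hφ.mapsTo (hsub hb))).1,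
      (hφlead k hk b (hsub hb)).1 (mem_Dset.1 hb).2⟩
  · obtain ⟨b, hb, rfl⟩ := hφ.surjOn (hsub' hy)
    exact ⟨b, mem_Dset.2 ⟨(mem_Dset.1 hb).1, (hφlead k hk b hb).2 (mem_Dset.1 hy).2⟩, rfl⟩

/-- In equilibrium, an agent has threshold at least that of any other agent whose led agents
contribute the same factors to the utilities. -/
theorem IsEqm.threshold_le_of_prod_Dset_eq {H : SimpleGraph V} {p : V} {l u c M : ℝ}
    {F : ℝ → ℝ} (hFpos : ∀ q ∈ Set.Ioc l u, 0 < F q) {r : V → ℝ}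
    (heqm : IsEqm H p l u c M F r) {i j : V} (hi : i ∈ agents p) (hj : j ∈ agents p)
    (hprod : ∀ q, ∏ k ∈ Dset H p i, F (max (r k) q) = ∏ k ∈ Dset H p j, F (max (r k) q)) :
    r j ≤ r i := by
  obtain ⟨hmem, hpos, hthr⟩ := heqm
  by_contra! hlt
  have hl : l < r j := (hmem i hi).1.trans_lt hlt
  have hF : ∀ k ∈ agents p, 0 < F (max (r k) (r j)) := fun k hk =>
    hFpos _ ⟨lt_max_of_lt_right hl, max_le (hmem k hk).2 (hmem j hj).2⟩
  have hD : 0 < ∏ k ∈ Dset H p j, F (max (r k) (r j)) :=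
    Finset.prod_pos fun k hk => hF k (mem_Dset.1 hk).1
  have hP : ∏ k ∈ Pset H p i, F (max (r k) (r j)) = ∏ k ∈ Pset H p j, F (max (r k) (r j)) := by
    have h := (prod_agents_eq H hi fun k => F (max (r k) (r j))).symm.trans
      (prod_agents_eq H hj fun k => F (max (r k) (r j)))
    rw [hprod, max_eq_right hlt.le, max_self] at h
    exact mul_right_cancel₀ (mul_pos (hFpos _ ⟨hl, (hmem j hj).2⟩) hD).ne' h
  have hi' := hpos i hi (r j) ⟨hlt, (hmem j hj).2⟩
  have hj' := (hthr j hj).resolve_left hl.ne'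
  rw [piU, hP] at hi'
  exact absurd hj' hi'.not_ge

/-- Agents of the same type have identical thresholds (Theorem 5): if the sets of agents
led by `i` and by `j` are related by a leads-preserving bijection, then `r i = r j`. -/
theorem same_type_same_threshold {V : Type*} [Fintype V] [DecidableEq V]
    (H : SimpleGraph V) (p : V) (hreach : ∀ v : V, Nonempty (H.Walk p v))
    (l u c M : ℝ) (hlu : l < u) (hc : 0 < c) (hcM : c < M)
    (F : ℝ → ℝ) (hFcont : ContinuousOn F (Set.Icc l u))
    (hFmono : StrictMonoOn F (Set.Icc l u)) (hFl : F l = 0) (hFu : F u = 1)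
    (r : V → ℝ) (heqm : IsEqm H p l u c M F r)
    (i j : V) (hi : i ∈ agents p) (hj : j ∈ agents p) (φ : V → V)
    (hφ : Set.BijOn φ (Dset H p i : Set V) (Dset H p j : Set V))
    (hφlead : ∀ a ∈ Dset H p i, ∀ b ∈ Dset H p i,
      (Leads H p a b ↔ Leads H p (φ a) (φ b))) :
    r i = r j := by
  have hFpos : ∀ q ∈ Set.Ioc l u, 0 < F q := fun q hq =>
    hFl ▸ hFmono (Set.left_mem_Icc.2 hlu.le) (Set.Ioc_subset_Icc_self hq) hq.1
  induction hn : (Dset H p i).card using Nat.strong_induction_on generalizing i j with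
  | _ n ih =>
    have hr : ∀ k ∈ Dset H p i, r k = r (φ k) := fun k hk => by
      have hssub := Dset_ssubset_of_mem (hreach k) hk
      exact ih _ (hn ▸ Finset.card_lt_card hssub) k (φ k) (mem_Dset.1 hk).1
        (mem_Dset.1 (hφ.mapsTo hk)).1 (bijOn_Dset_of_mem hreach hφ hφlead hk)
        (fun a ha b hb => hφlead a (hssub.1 ha) b (hssub.1 hb)) rfl
    have hprod : ∀ q, ∏ k ∈ Dset H p i, F (max (r k) q) = ∏ k ∈ Dset H p j, F (max (r k) q) :=
      fun q => Finset.prod_nbij φ hφ.mapsTo hφ.injOn hφ.surjOn fun k hk => by rw [hr k hk]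
    exact le_antisymm
      (heqm.threshold_le_of_prod_Dset_eq hFpos hj hi fun q => (hprod q).symm)
      (heqm.threshold_le_of_prod_Dset_eq hFpos hi hj hprod)
end
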